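/- arXiv:2511.23012 — 2 statements merged into one kernel-verified Lean document; each statement's English description precedes it below -/
import Mathlib

section
/- Let G be a connected finite simple graph, let S be a configuration of G with |S| = k, let C ⊆ V(G) with |C| ≤ k, and let b be a natural number. Then there exists a configuration T with C ⊆ T and |T| = k that is reachable from S in at most b token-sliding steps if and only if there exists an injection μ : C → S with ∑_{c ∈ C} dist(μ(c), c) ≤ b. -/
/-- Two configurations (sets of tokens) are adjacent if one is obtained from the
other by sliding a single token along an edge. -/
def ConfigAdj {V : Type*} [DecidableEq V] (G : SimpleGraph V) (S S' : Finset V) : Prop :=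
  ∃ x ∈ S, ∃ y ∉ S, G.Adj x y ∧ S' = insert y (S.erase x)

/-- `T` is reachable from `S` in at most `b` token-sliding steps. -/
def ReachableIn {V : Type*} [DecidableEq V] (G : SimpleGraph V) (S T : Finset V) (b : ℕ) : Prop :=
  ∃ (ℓ : ℕ) (f : ℕ → Finset V), ℓ ≤ b ∧ f 0 = S ∧ f ℓ = T ∧
    ∀ i < ℓ, ConfigAdj G (f i) (f (i + 1))

theorem ReachableIn.head {V : Type*} [DecidableEq V] {G : SimpleGraph V} {S S' T : Finset V}
    {b : ℕ} (h : ConfigAdj G S S') (hr : ReachableIn G S' T b) : ReachableIn G S T (b + 1) := by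
  obtain ⟨ℓ, f, hℓ, h0, hT, hf⟩ := hr
  refine ⟨ℓ + 1, fun i => Nat.casesOn i S f, by omega, rfl, hT, ?_⟩
  rintro (_ | i) hi
  · simpa [h0] using h
  · exact hf i (by omega)

theorem ConfigAdj.card_eq {V : Type*} [DecidableEq V] {G : SimpleGraph V} {S S' : Finset V}
    (h : ConfigAdj G S S') : S'.card = S.card := by
  obtain ⟨x, hx, y, hy, -, rfl⟩ := h
  rw [Finset.card_insert_of_notMem (fun h => hy (Finset.mem_of_mem_erase h)),
    Finset.card_erase_add_one hx]

theorem SimpleGraph.Connected.exists_adj_dist_lt {V : Type*} {G : SimpleGraph V}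
    (hG : G.Connected) {u v : V} (h : u ≠ v) :
    ∃ y, G.Adj u y ∧ G.dist y v + 1 ≤ G.dist u v := by
  obtain ⟨p, hp⟩ := hG.exists_walk_length_eq_dist u v
  cases p with
  | nil => exact absurd rfl h
  | cons hadj q =>
    refine ⟨_, hadj, ?_⟩
    have := SimpleGraph.dist_le q
    rw [SimpleGraph.Walk.length_cons] at hp
    omega

/-- Following the tokens along a sequence of slides matches the final configuration with the
initial one, at total distance at most the number of slides. -/
theorem exists_matching_of_slides {V : Type*} [DecidableEq V] {G : SimpleGraph V}
    (hG : G.Connected) (f : ℕ → Finset V) (ℓ : ℕ)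
    (hf : ∀ i < ℓ, ConfigAdj G (f i) (f (i + 1))) :
    ∃ μ : V → V, Set.InjOn μ (f ℓ) ∧ (∀ c ∈ f ℓ, μ c ∈ f 0) ∧
      ∑ c ∈ f ℓ, G.dist (μ c) c ≤ ℓ := by
  induction ℓ with
  | zero => exact ⟨id, Function.injective_id.injOn, fun c hc => hc, by simp⟩
  | succ ℓ ih =>
    obtain ⟨μ, hinj, hmaps, hsum⟩ := ih fun i hi => hf i (by omega)
    obtain ⟨x, hx, y, hy, hadj, heq⟩ := hf ℓ (by omega)
    have hy' : y ∉ (f ℓ).erase x := fun h => hy (Finset.mem_of_mem_erase h)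
    have hne : ∀ c ∈ (f ℓ).erase x, c ≠ y := fun c hc h => hy' (h ▸ hc)
    refine ⟨Function.update μ y (μ x), ?_, ?_, ?_⟩
    · rw [heq]
      intro a ha b hb hab
      simp only [Finset.coe_insert, Finset.coe_erase, Set.mem_insert_iff, Set.mem_sdiff,
        Finset.mem_coe, Set.mem_singleton_iff] at ha hb
      have hinj_fin : ∀ a ∈ f ℓ, ∀ b ∈ f ℓ, μ a = μ b → a = b := fun a ha b hb h => hinj ha hb h
      simp only [Function.update_apply] at hab
      grind
    · rw [heq]
      intro c hc
      rw [Function.update_apply]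
      grind
    · rw [heq, Finset.sum_insert hy', Function.update_self]
      have h1 : ∑ c ∈ (f ℓ).erase x, G.dist (Function.update μ y (μ x) c) c =
          ∑ c ∈ (f ℓ).erase x, G.dist (μ c) c :=
        Finset.sum_congr rfl fun c hc => by rw [Function.update_of_ne (hne c hc)]
      have h2 := Finset.add_sum_erase (f ℓ) (fun c => G.dist (μ c) c) hx
      have h3 := hG.dist_triangle (u := μ x) (v := x) (w := y)
      have h4 := SimpleGraph.dist_eq_one_iff_adj.mpr hadj
      omega

/-- If a target `c` is not covered, some token can slide so that the cost of a matching drops. -/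
theorem exists_slide_of_notMem {V : Type*} [DecidableEq V] {G : SimpleGraph V}
    (hG : G.Connected) {S C : Finset V} {μ : V → V} (hinj : Set.InjOn μ C)
    (hmaps : ∀ c ∈ C, μ c ∈ S) {c : V} (hc : c ∈ C) (hcS : c ∉ S) :
    ∃ (S' : Finset V) (ν : V → V), ConfigAdj G S S' ∧ Set.InjOn ν C ∧ (∀ a ∈ C, ν a ∈ S') ∧
      ∑ a ∈ C, G.dist (ν a) a + 1 ≤ ∑ a ∈ C, G.dist (μ a) a := by
  obtain ⟨w, hw, hmin⟩ := Finset.exists_min_image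
    (S.filter fun w => G.dist (μ c) w + G.dist w c ≤ G.dist (μ c) c) (fun w => G.dist w c)
    ⟨μ c, by simp [hmaps c hc]⟩
  obtain ⟨hwS, hgeo⟩ := Finset.mem_filter.mp hw
  obtain ⟨y, hadj, hlt⟩ := hG.exists_adj_dist_lt (u := w) (v := c) fun h => hcS (h ▸ hwS)
  have hyS : y ∉ S := fun hy => by
    have h1 := hG.dist_triangle (u := μ c) (v := w) (w := y)
    have h2 := SimpleGraph.dist_eq_one_iff_adj.mpr hadj
    have h3 := hmin y (Finset.mem_filter.mpr ⟨hy, by omega⟩)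
    omega
  have hinj' : ∀ a ∈ C, ∀ b ∈ C, μ a = μ b → a = b := fun a ha b hb h => hinj ha hb h
  let ν : V → V := fun a => if a = c then y else if μ a = w then μ c else μ a
  refine ⟨_, ν, ⟨w, hwS, y, hyS, hadj, rfl⟩, ?_, ?_, ?_⟩
  · intro a ha b hb hab
    rw [Finset.mem_coe] at ha hb
    simp only [ν] at hab
    grind
  · intro a ha
    simp only [ν]
    grind
  · have hbound : ∑ a ∈ C.erase c, G.dist (ν a) a ≤
        ∑ a ∈ C.erase c, G.dist (μ a) a + G.dist (μ c) w := by
      calc ∑ a ∈ C.erase c, G.dist (ν a) a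
          ≤ ∑ a ∈ C.erase c, (G.dist (μ a) a + if μ a = w then G.dist (μ c) w else 0) := by
            refine Finset.sum_le_sum fun a ha => ?_
            simp only [ν, if_neg (Finset.ne_of_mem_erase ha)]
            split_ifs with h
            · have := hG.dist_triangle (u := μ c) (v := w) (w := a)
              rw [h]
              omega
            · simp
        _ ≤ _ := by
            rw [Finset.sum_add_distrib, ← Finset.sum_filter, Finset.sum_const, smul_eq_mul]
            have hcard : ((C.erase c).filter fun a => μ a = w).card ≤ 1 :=
              Finset.card_le_one.mpr fun a ha b hb => by grind
            gcongr
            exact (Nat.mul_le_mul_right _ hcard).trans_eq (one_mul _)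
    have h1 := Finset.add_sum_erase C (fun a => G.dist (μ a) a) hc
    have h2 := Finset.add_sum_erase C (fun a => G.dist (ν a) a) hc
    have h3 : ν c = y := if_pos rfl
    simp only [h3] at h1 h2
    omega

theorem exists_reachableIn_of_matching {V : Type*} [DecidableEq V] {G : SimpleGraph V}
    (hG : G.Connected) (C : Finset V) (b : ℕ) (S : Finset V) (μ : V → V)
    (hinj : Set.InjOn μ C) (hmaps : ∀ c ∈ C, μ c ∈ S) (hsum : ∑ c ∈ C, G.dist (μ c) c ≤ b) :
    ∃ T : Finset V, C ⊆ T ∧ T.card = S.card ∧ ReachableIn G S T b := by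
  induction b generalizing S μ with
  | zero =>
    refine ⟨S, fun c hc => ?_, rfl, 0, fun _ => S, le_rfl, rfl, rfl, by simp⟩
    by_contra hcS
    obtain ⟨_, _, _, _, _, h⟩ := exists_slide_of_notMem hG hinj hmaps hc hcS
    omega
  | succ b ih =>
    by_cases hCS : C ⊆ S
    · exact ⟨S, hCS, rfl, 0, fun _ => S, Nat.zero_le _, rfl, rfl, by simp⟩
    obtain ⟨c, hc, hcS⟩ := Finset.not_subset.mp hCS
    obtain ⟨S', ν, hadj, hinj', hmaps', h⟩ := exists_slide_of_notMem hG hinj hmaps hc hcS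
    obtain ⟨T, hCT, hT, hr⟩ := ih S' ν hinj' hmaps' (by omega)
    exact ⟨T, hCT, hT.trans hadj.card_eq, hr.head hadj⟩

theorem stmt_12 {V : Type*} [Fintype V] [DecidableEq V] (G : SimpleGraph V)
    (hG : G.Connected) (k : ℕ) (S : Finset V) (hS : S.card = k)
    (C : Finset V) (hC : C.card ≤ k) (b : ℕ) :
    (∃ T : Finset V, C ⊆ T ∧ T.card = k ∧ ReachableIn G S T b) ↔
    (∃ μ : {x // x ∈ C} → {x // x ∈ S}, Function.Injective μ ∧
      ∑ c ∈ C.attach, G.dist (μ c).1 c.1 ≤ b) := by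
  constructor
  · rintro ⟨T, hCT, -, ℓ, f, hℓ, rfl, rfl, hf⟩
    obtain ⟨μ, hinj, hmaps, hsum⟩ := exists_matching_of_slides hG f ℓ hf
    refine ⟨fun c => ⟨μ c, hmaps c (hCT c.2)⟩, fun a b hab => ?_, ?_⟩
    · exact Subtype.ext (hinj (hCT a.2) (hCT b.2) (congrArg Subtype.val hab))
    · rw [Finset.sum_attach C fun c => G.dist (μ c) c]
      exact (Finset.sum_le_sum_of_subset hCT).trans (hsum.trans hℓ)
  · rintro ⟨μ, hinj, hsum⟩
    let ν : V → V := fun c => if h : c ∈ C then μ ⟨c, h⟩ else c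
    have hν : ∀ c (h : c ∈ C), ν c = μ ⟨c, h⟩ := fun c h => dif_pos h
    subst hS
    refine exists_reachableIn_of_matching hG C b S ν (fun a ha b hb hab => ?_)
      (fun c hc => hν c hc ▸ (μ ⟨c, hc⟩).2) ?_
    · rw [hν a ha, hν b hb] at hab
      exact congrArg Subtype.val (hinj (Subtype.ext hab))
    · rw [← Finset.sum_attach]
      simpa only [hν _ (Subtype.prop _)] using hsum
end

section
/- Let U = {u_1, ..., u_{3n}} be a set of 3n elements and 𝒳 = {X_1, ..., X_m} a family of 3-element subsets of U. Let G be the finite simple graph defined as follows: take a clique on Q = {q_0, q_1, ..., q_{3n}}; for each i ∈ [m], add a star A_i with center v_i and four leaves v_i^1, v_i^2, v_i^3, v_i^4 (edges v_i v_i^j for j ∈ [4]); and make each of the five vertices of A_i adjacent to q_j for every u_j ∈ X_i; there are no other vertices or edges. Let S = {v_i^j : i ∈ [m], j ∈ [4]} and b = 4n. Then there exists a subfamily of 𝒳 consisting of exactly n sets whose union is U if and only if some vertex cover of G is reachable from S in at most b token-sliding steps. -/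
/-- `C` is a vertex cover of `G`: every edge has an endpoint in `C`. -/
def IsVertexCover {V : Type*} (G : SimpleGraph V) (C : Finset V) : Prop :=
  ∀ ⦃u v : V⦄, G.Adj u v → u ∈ C ∨ v ∈ C

/-- The graph constructed from an instance of Exact Cover by 3-Sets: a clique on
`Q = {q_0, q_1, …, q_{3n}}` (vertex `Sum.inl none` is `q_0` and `Sum.inl (some j)`
is `q_{j+1}`, corresponding to element `u_{j+1}`); for each `i ∈ [m]` a star `A_i`
with center `v_i = Sum.inr (i, 0)` and four leaves `v_i^j = Sum.inr (i, j)`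
(`j ≠ 0`); and each of the five vertices of `A_i` is adjacent to `q_j` for every
element `u_j ∈ X_i`. There are no other vertices or edges. -/
def x3cGraph (n m : ℕ) (X : Fin m → Finset (Fin (3 * n))) :
    SimpleGraph (Option (Fin (3 * n)) ⊕ (Fin m × Fin 5)) :=
  SimpleGraph.fromRel (fun x y =>
    (∃ a b : Option (Fin (3 * n)), x = Sum.inl a ∧ y = Sum.inl b) ∨
    (∃ (i : Fin m) (j : Fin 5), j ≠ 0 ∧ x = Sum.inr (i, 0) ∧ y = Sum.inr (i, j)) ∨
    (∃ (i : Fin m) (j : Fin 5) (u : Fin (3 * n)), u ∈ X i ∧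
      x = Sum.inr (i, j) ∧ y = Sum.inl (some u)))

section TokenSliding

variable {V : Type*} [DecidableEq V] {G : SimpleGraph V}

theorem ReachableIn.refl (S : Finset V) : ReachableIn G S S 0 :=
  ⟨0, fun _ => S, le_rfl, rfl, rfl, fun i hi => absurd hi (Nat.not_lt_zero i)⟩

theorem ReachableIn.snoc {S C C' : Finset V} {b : ℕ} (h : ReachableIn G S C b)
    (hC : ConfigAdj G C C') : ReachableIn G S C' (b + 1) := by
  obtain ⟨l, f, hl, h0, h1, hf⟩ := h
  refine ⟨l + 1, fun i => if i ≤ l then f i else C', by omega, by simpa using h0, by simp, ?_⟩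
  intro i hi
  rcases Nat.lt_succ_iff_lt_or_eq.mp hi with h | rfl
  · have h2 : i + 1 ≤ l := h
    simpa [h.le, h2] using hf i h
  · simpa [h1] using hC

/-- Tokens can be slid simultaneously, one step each, to distinct empty neighbours. -/
theorem reachableIn_sdiff_union_image {S : Finset V} (g : V → V) (E : Finset V) (hE : E ⊆ S)
    (hg : ∀ x ∈ E, g x ∉ S) (hadj : ∀ x ∈ E, G.Adj x (g x)) (hinj : Set.InjOn g E) :
    ReachableIn G S ((S \ E) ∪ E.image g) E.card := by
  induction E using Finset.induction_on with
  | empty => simpa using ReachableIn.refl S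
  | insert a E ha ih =>
    rw [Finset.card_insert_of_notMem ha]
    have hsub : E ⊆ insert a E := Finset.subset_insert a E
    refine (ih (hsub.trans hE) (fun x hx => hg x (hsub hx)) (fun x hx => hadj x (hsub hx))
      (hinj.mono (by exact_mod_cast hsub))).snoc ?_
    have haS : a ∈ S := hE (Finset.mem_insert_self a E)
    have hga := hg a (Finset.mem_insert_self a E)
    have hgE : g a ∉ E.image g := by
      intro h
      obtain ⟨x, hx, hxa⟩ := Finset.mem_image.mp h
      have : x = a := hinj (by simp [hx]) (by simp) hxa
      exact ha (this ▸ hx)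
    have haE : a ∉ E.image g := by
      intro h
      obtain ⟨x, hx, hxa⟩ := Finset.mem_image.mp h
      exact hg x (hsub hx) (hxa ▸ haS)
    refine ⟨a, by simp [haS, ha], g a, by
      rw [Finset.mem_union, not_or]; exact ⟨by simp [hga], hgE⟩,
      hadj a (Finset.mem_insert_self a E), ?_⟩
    ext z
    rw [Finset.image_insert]
    simp only [Finset.mem_union, Finset.mem_insert, Finset.mem_sdiff, Finset.mem_erase]
    by_cases hz : z = a
    · subst hz
      tauto
    · tauto

/-- A configuration has at most as many tokens off the initial positions as steps were made. If
this is attained, then every step moved a token off its initial position for the first time. -/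
theorem card_sdiff_le_of_configAdj {S : Finset V} (f : ℕ → Finset V) (h0 : f 0 = S) (l : ℕ)
    (hf : ∀ i < l, ConfigAdj G (f i) (f (i + 1))) :
    (f l).card = S.card ∧ (f l \ S).card ≤ l ∧
      ((f l \ S).card = l → ∀ y ∈ f l \ S, ∃ x ∈ S \ f l, G.Adj x y) := by
  induction l with
  | zero => simp [h0]
  | succ l ih =>
    obtain ⟨hcard, hle, hnb⟩ := ih fun i hi => hf i (by omega)
    obtain ⟨x, hx, y, hy, hxy, heq⟩ := hf l (by omega)
    have hsub : f (l + 1) \ S ⊆ insert y (f l \ S) := by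
      rw [heq]
      intro z
      simp only [Finset.mem_sdiff, Finset.mem_insert, Finset.mem_erase]
      tauto
    have hle' := (Finset.card_le_card hsub).trans (Finset.card_insert_le y _)
    refine ⟨?_, by omega, fun hl => ?_⟩
    · rw [heq, Finset.card_insert_of_notMem (by simp [hy]), Finset.card_erase_of_mem hx]
      have := Finset.card_pos.mpr ⟨x, hx⟩
      omega
    · have heq' : f (l + 1) \ S = insert y (f l \ S) :=
        Finset.eq_of_subset_of_card_le hsub ((Finset.card_insert_le y _).trans (by omega))
      have hyS : y ∉ S :=
        (Finset.mem_sdiff.mp (heq' ▸ Finset.mem_insert_self y _)).2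
      have hne : x ≠ y := G.ne_of_adj hxy
      have hxf : x ∉ f (l + 1) := by simp [heq, hne]
      have hxS : x ∈ S := by
        by_contra hxS
        have : x ∈ f (l + 1) \ S := by
          rw [heq']
          simp [hx, hxS]
        exact hxf (Finset.mem_sdiff.mp this).1
      intro z hz
      rw [heq', Finset.mem_insert] at hz
      rcases hz with rfl | hz
      · exact ⟨x, by simp [hxS, hxf], hxy⟩
      · obtain ⟨w, hw, hwz⟩ := hnb (by omega) z hz
        rw [Finset.mem_sdiff] at hw
        refine ⟨w, Finset.mem_sdiff.mpr ⟨hw.1, fun hwf => ?_⟩, hwz⟩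
        rw [heq, Finset.mem_insert, Finset.mem_erase] at hwf
        rcases hwf with rfl | hwf
        · exact hyS hw.1
        · exact hw.2 hwf.2

end TokenSliding

section ExactCover

variable {n m : ℕ} {X : Fin m → Finset (Fin (3 * n))}

theorem x3cGraph_adj_inl {a b : Option (Fin (3 * n))} :
    (x3cGraph n m X).Adj (Sum.inl a) (Sum.inl b) ↔ a ≠ b := by
  simp [x3cGraph]

theorem x3cGraph_adj_inr_inl {p : Fin m × Fin 5} {a : Option (Fin (3 * n))} :
    (x3cGraph n m X).Adj (Sum.inr p) (Sum.inl a) ↔ ∃ u ∈ X p.1, a = some u := by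
  obtain ⟨i, j⟩ := p
  simp [x3cGraph]

theorem x3cGraph_adj_inr {p q : Fin m × Fin 5} :
    (x3cGraph n m X).Adj (Sum.inr p) (Sum.inr q) ↔
      p.1 = q.1 ∧ (p.2 = 0 ∧ q.2 ≠ 0 ∨ p.2 ≠ 0 ∧ q.2 = 0) := by
  obtain ⟨i, j⟩ := p
  obtain ⟨i', j'⟩ := q
  simp only [x3cGraph, SimpleGraph.fromRel_adj, ne_eq, Sum.inr.injEq, Prod.mk.injEq]
  constructor
  · rintro ⟨-, h | h⟩ <;> simp at h <;> grind
  · rintro ⟨rfl, ⟨rfl, h⟩ | ⟨h, rfl⟩⟩ <;> simp [h, Ne.symm h]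

/-- The set of all leaves of the stars. -/
def starLeaves (n m : ℕ) : Finset (Option (Fin (3 * n)) ⊕ (Fin m × Fin 5)) :=
  ((Finset.univ : Finset (Fin m × Fin 5)).filter fun p => p.2 ≠ 0).image Sum.inr

@[simp]
theorem inl_notMem_starLeaves (a : Option (Fin (3 * n))) : Sum.inl a ∉ starLeaves n m := by
  simp [starLeaves]

@[simp]
theorem inr_mem_starLeaves {p : Fin m × Fin 5} : Sum.inr p ∈ starLeaves n m ↔ p.2 ≠ 0 := by
  obtain ⟨i, j⟩ := p
  simp [starLeaves]

theorem card_image_leaves (B : Finset (Fin m)) :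
    ((B ×ˢ (Finset.univ.filter fun l : Fin 5 => l ≠ 0)).image
      (Sum.inr : _ → Option (Fin (3 * n)) ⊕ (Fin m × Fin 5))).card = 4 * B.card := by
  rw [Finset.card_image_of_injective _ Sum.inr_injective, Finset.card_product, mul_comm]
  rfl

theorem card_starLeaves : (starLeaves n m).card = 4 * m := by
  have h := card_image_leaves (n := n) (Finset.univ : Finset (Fin m))
  rw [Finset.card_univ, Fintype.card_fin] at h
  rw [← h]
  congr 1
  ext v
  simp [starLeaves]

theorem exists_exactCover_of_reachableIn
    {T : Finset (Option (Fin (3 * n)) ⊕ (Fin m × Fin 5))}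
    (hT : IsVertexCover (x3cGraph n m X) T)
    (hR : ReachableIn (x3cGraph n m X) (starLeaves n m) T (4 * n)) :
    ∃ 𝒮 : Finset (Fin m), 𝒮.card = n ∧ 𝒮.biUnion X = Finset.univ := by
  obtain ⟨l, f, hl, h0, rfl, hf⟩ := hR
  obtain ⟨hcard, hle, hnb⟩ := card_sdiff_le_of_configAdj f h0 l hf
  set T := f l
  rw [card_starLeaves] at hcard
  set A : Finset (Option (Fin (3 * n))) := Finset.univ.filter fun a => Sum.inl a ∈ T with hA
  set B : Finset (Fin m) := Finset.univ.filter fun i => Sum.inr (i, 0) ∈ T with hB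
  have hAcard : 3 * n ≤ A.card := by
    have h1 : Aᶜ.card ≤ 1 := by
      refine Finset.card_le_one.mpr fun a ha b hb => ?_
      by_contra hab
      have := hT (x3cGraph_adj_inl.mpr hab)
      simp only [hA, Finset.mem_compl, Finset.mem_filter, Finset.mem_univ, true_and] at ha hb
      tauto
    have h2 := Finset.card_add_card_compl A
    simp only [Fintype.card_option, Fintype.card_fin] at h2
    omega
  have hAB : A.card + B.card ≤ (T \ starLeaves n m).card := by
    have hsub : A.disjSum (B.image fun i => (i, (0 : Fin 5))) ⊆ T \ starLeaves n m := by
      rintro (a | ⟨i, j⟩) hv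
      · simpa [hA] using hv
      · simp only [Finset.inr_mem_disjSum, Finset.mem_image, Prod.mk.injEq] at hv
        obtain ⟨i', hi', rfl, rfl⟩ := hv
        simpa [hB] using hi'
    have := Finset.card_le_card hsub
    rwa [Finset.card_disjSum, Finset.card_image_of_injective] at this
    intro i j h
    exact (Prod.mk.inj h).1
  have hleaf : ∀ i ∉ B, ∀ j : Fin 5, j ≠ 0 → Sum.inr (i, j) ∈ T := by
    intro i hi j hj
    have hadj := (x3cGraph_adj_inr (X := X) (p := (i, 0)) (q := (i, j))).mpr ⟨rfl, .inl ⟨rfl, hj⟩⟩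
    refine (hT hadj).resolve_left ?_
    simpa [hB] using hi
  have hleaves : 4 * Bᶜ.card ≤ (T ∩ starLeaves n m).card := by
    rw [← card_image_leaves (n := n)]
    refine Finset.card_le_card fun v hv => ?_
    obtain ⟨⟨i, j⟩, hp, rfl⟩ := Finset.mem_image.mp hv
    simp only [Finset.mem_product, Finset.mem_compl, Finset.mem_filter, Finset.mem_univ,
      true_and] at hp
    simpa [hp.2] using hleaf i hp.1 j hp.2
  have hsum := Finset.card_sdiff_add_card_inter T (starLeaves n m)
  have hBc := Finset.card_add_card_compl B
  rw [Fintype.card_fin] at hBc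
  refine ⟨B, by omega, ?_⟩
  have hnb := hnb (by omega)
  have hq : Sum.inl none ∉ T := by
    intro h
    obtain ⟨x | p, hx, hadj⟩ := hnb (Sum.inl none) (by simp [h])
    · simp at hx
    · simp [x3cGraph_adj_inr_inl] at hadj
  refine Finset.eq_univ_iff_forall.mpr fun u => ?_
  have hu : Sum.inl (some u) ∈ T :=
    (hT (x3cGraph_adj_inl (a := none) (b := some u).mpr (by simp))).resolve_left hq
  obtain ⟨x | ⟨i, j⟩, hx, hadj⟩ := hnb (Sum.inl (some u)) (by simp [hu])
  · simp at hx
  · obtain ⟨u', hu', huu⟩ := x3cGraph_adj_inr_inl.mp hadj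
    obtain rfl := Option.some.inj huu
    simp only [Finset.mem_sdiff, inr_mem_starLeaves] at hx
    refine Finset.mem_biUnion.mpr ⟨i, ?_, hu'⟩
    by_contra hi
    exact hx.2 (hleaf i hi j hx.1)

/-- The slide of a leaf token: the first three leaves of the star `i` move to the elements
`h i 0`, `h i 1`, `h i 2`, and the fourth leaf moves to the center. -/
def leafSlide (h : Fin m → Fin 3 → Fin (3 * n)) :
    Option (Fin (3 * n)) ⊕ (Fin m × Fin 5) → Option (Fin (3 * n)) ⊕ (Fin m × Fin 5)
  | Sum.inl a => Sum.inl a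
  | Sum.inr (i, 1) => Sum.inl (some (h i 0))
  | Sum.inr (i, 2) => Sum.inl (some (h i 1))
  | Sum.inr (i, 3) => Sum.inl (some (h i 2))
  | Sum.inr (i, _) => Sum.inr (i, 0)

theorem exists_reachableIn_of_exactCover (hX : ∀ i, (X i).card = 3) {𝒮 : Finset (Fin m)}
    (hcard : 𝒮.card = n) (hcover : 𝒮.biUnion X = Finset.univ) :
    ∃ T, IsVertexCover (x3cGraph n m X) T ∧
      ReachableIn (x3cGraph n m X) (starLeaves n m) T (4 * n) := by
  let e := fun i => (X i).equivFinOfCardEq (hX i)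
  set h : Fin m → Fin 3 → Fin (3 * n) := fun i k => (e i).symm k with hh
  have hmem : ∀ i k, h i k ∈ X i := fun i k => ((e i).symm k).2
  have hsurj : Function.Surjective fun p : 𝒮 × Fin 3 => h p.1 p.2 := by
    intro u
    obtain ⟨i, hi, hu⟩ := Finset.mem_biUnion.mp (hcover ▸ Finset.mem_univ u)
    exact ⟨(⟨i, hi⟩, e i ⟨u, hu⟩), by simp [hh]⟩
  have hinj : Function.Injective fun p : 𝒮 × Fin 3 => h p.1 p.2 :=
    ((Fintype.bijective_iff_surjective_and_card _).mpr ⟨hsurj, by simp [hcard, mul_comm]⟩).1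
  have hinj' : ∀ i ∈ 𝒮, ∀ i' ∈ 𝒮, ∀ k k', h i k = h i' k' → i = i' ∧ k = k' := by
    intro i hi i' hi' k k' heq
    have := @hinj (⟨i, hi⟩, k) (⟨i', hi'⟩, k') heq
    simpa using this
  set E : Finset (Option (Fin (3 * n)) ⊕ (Fin m × Fin 5)) :=
    (𝒮 ×ˢ (Finset.univ.filter fun l : Fin 5 => l ≠ 0)).image Sum.inr with hE
  have hEmem : ∀ v, v ∈ E ↔ ∃ i ∈ 𝒮, ∃ j : Fin 5, j ≠ 0 ∧ v = Sum.inr (i, j) := by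
    intro v
    simp only [hE, Finset.mem_image, Finset.mem_product, Finset.mem_filter, Finset.mem_univ,
      true_and, Prod.exists]
    grind
  have hEcard : E.card = 4 * n := by rw [hE, card_image_leaves, hcard]
  refine ⟨(starLeaves n m \ E) ∪ E.image (leafSlide h), ?_, hEcard ▸
    reachableIn_sdiff_union_image (leafSlide h) E ?_ ?_ ?_ ?_⟩
  · have hsome : ∀ u, Sum.inl (some u) ∈ (starLeaves n m \ E) ∪ E.image (leafSlide h) := by
      intro u
      obtain ⟨⟨⟨i, hi⟩, k⟩, rfl⟩ := hsurj u
      refine Finset.mem_union_right _ (Finset.mem_image.mpr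
        ⟨Sum.inr (i, k.succ.castSucc), (hEmem _).mpr ⟨i, hi, _, ?_, rfl⟩, ?_⟩)
      · fin_cases k <;> simp
      · fin_cases k <;> rfl
    have hstar : ∀ i, ∀ j : Fin 5, j ≠ 0 →
        Sum.inr (i, 0) ∈ (starLeaves n m \ E) ∪ E.image (leafSlide h) ∨
        Sum.inr (i, j) ∈ (starLeaves n m \ E) ∪ E.image (leafSlide h) := by
      intro i j hj
      by_cases hi : i ∈ 𝒮
      · exact .inl (Finset.mem_union_right _ (Finset.mem_image.mpr
          ⟨Sum.inr (i, 4), (hEmem _).mpr ⟨i, hi, 4, by decide, rfl⟩, rfl⟩))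
      · refine .inr (Finset.mem_union_left _ (Finset.mem_sdiff.mpr ⟨by simpa using hj, ?_⟩))
        rw [hEmem]
        rintro ⟨i', hi', j', -, heq⟩
        simp only [Sum.inr.injEq, Prod.mk.injEq] at heq
        exact hi (heq.1 ▸ hi')
    rintro (a | ⟨i, j⟩) (b | ⟨i', j'⟩) hadj
    · rw [x3cGraph_adj_inl] at hadj
      rcases a with _ | a
      · rcases b with _ | b
        · exact absurd rfl hadj
        · exact .inr (hsome b)
      · exact .inl (hsome a)
    · obtain ⟨u, -, rfl⟩ := x3cGraph_adj_inr_inl.mp hadj.symm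
      exact .inl (hsome u)
    · obtain ⟨u, -, rfl⟩ := x3cGraph_adj_inr_inl.mp hadj
      exact .inr (hsome u)
    · obtain ⟨rfl, ⟨hj, hj'⟩ | ⟨hj, hj'⟩⟩ := x3cGraph_adj_inr.mp hadj
      · obtain rfl : j = 0 := hj
        exact hstar i j' hj'
      · obtain rfl : j' = 0 := hj'
        exact (hstar i j hj).symm
  · intro v hv
    obtain ⟨i, -, j, hj, rfl⟩ := (hEmem v).mp hv
    simpa using hj
  · intro v hv
    obtain ⟨i, -, j, hj, rfl⟩ := (hEmem v).mp hv
    fin_cases j <;> simp [leafSlide] at hj ⊢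
  · intro v hv
    obtain ⟨i, -, j, hj, rfl⟩ := (hEmem v).mp hv
    fin_cases j <;> simp [leafSlide, x3cGraph_adj_inr_inl, x3cGraph_adj_inr, hmem] at hj ⊢
  · intro v hv w hw heq
    obtain ⟨i, hi, j, hj, rfl⟩ := (hEmem v).mp hv
    obtain ⟨i', hi', j', hj', rfl⟩ := (hEmem w).mp hw
    have key := hinj' i hi i' hi'
    fin_cases j <;> fin_cases j' <;> simp [leafSlide] at hj hj' heq ⊢ <;>
      first
        | exact heq
        | exact (key _ _ heq).1
        | exact absurd (key _ _ heq).2 (by decide)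

end ExactCover

theorem stmt_13 (n m : ℕ) (X : Fin m → Finset (Fin (3 * n)))
    (hX : ∀ i, (X i).card = 3) :
    (∃ 𝒮 : Finset (Fin m), 𝒮.card = n ∧ 𝒮.biUnion X = Finset.univ) ↔
    (∃ T : Finset (Option (Fin (3 * n)) ⊕ (Fin m × Fin 5)),
      IsVertexCover (x3cGraph n m X) T ∧
      ReachableIn (x3cGraph n m X)
        (((Finset.univ : Finset (Fin m × Fin 5)).filter fun p => p.2 ≠ 0).image Sum.inr)
        T (4 * n)) := by
  constructor
  · rintro ⟨𝒮, hcard, hcover⟩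
    exact exists_reachableIn_of_exactCover hX hcard hcover
  · rintro ⟨T, hT, hR⟩
    exact exists_exactCover_of_reachableIn hT hR
end
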